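/- Let φ be a monotonic enhancement of site percolation on the square lattice ℤ². Then φ is essential if and only if there exist a configuration ω containing no infinite open cluster and activation variables α ∈ {0,1}^{ℤ²} such that the enhanced configuration ω̂(ω,α) contains an infinite open cluster. -/

import Mathlib

open MeasureTheory Filter Set Topology
open scoped ENNReal

namespace PercEnh

/-- Sites of the lattice (vertex set `ℤ²`). -/
abbrev Site : Type := ℤ × ℤ

/-- A configuration: the set of open sites. -/
abbrev Config : Type := Set Site

/-- Square-lattice (`ℤ²`-) adjacency: `‖x − y‖₁ = 1`. -/
def adjZ2 (x y : Site) : Prop := |x.1 - y.1| + |x.2 - y.2| = 1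

/-- Matching (star) adjacency: `x ≠ y` and `‖x − y‖_∞ = 1`. -/
def adjStar (x y : Site) : Prop := x ≠ y ∧ max |x.1 - y.1| |x.2 - y.2| = 1

/-- Euclidean norm of a site. -/
noncomputable def siteNorm (x : Site) : ℝ := Real.sqrt ((x.1 : ℝ) ^ 2 + (x.2 : ℝ) ^ 2)

/-- Sites in the closed Euclidean ball of radius `r` centred at the origin. -/
def siteBall (r : ℝ) : Set Site := {x | siteNorm x ≤ r}

/-- The shifted configuration `τ_x ω = {y − x : y ∈ ω}`. -/
def shiftConfig (x : Site) (ω : Config) : Config := {y | y + x ∈ ω}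

/-- An enhancement function of (finite) range `R₀`: takes values in subsets of
`𝔹₀ = ℤ² ∩ B(R₀)` and depends only on the restriction of the configuration to `𝔹₀`. -/
def IsEnhancement (R₀ : ℝ) (φ : Config → Config) : Prop :=
  0 ≤ R₀ ∧ (∀ ω, φ ω ⊆ siteBall R₀) ∧
    ∀ ω ω' : Config, ω ∩ siteBall R₀ = ω' ∩ siteBall R₀ → φ ω = φ ω'

/-- A monotonic enhancement function. -/
def Monotonic (φ : Config → Config) : Prop := ∀ ω ω' : Config, ω ⊆ ω' → φ ω ⊆ φ ω'

/-- The translate `φ_x(ω) = x + φ₀(τ_x ω)`. -/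
def enhAt (φ : Config → Config) (x : Site) (ω : Config) : Config :=
  (fun z => z + x) '' φ (shiftConfig x ω)

/-- The enhanced configuration `ω̂(ω, α) = ω ∪ ⋃_{x : α(x)=1} φ_x(ω)`. -/
def enhanced (φ : Config → Config) (ω : Config) (α : Site → Bool) : Config :=
  ω ∪ {y | ∃ x, α x = true ∧ y ∈ enhAt φ x ω}

/-- The fully (deterministically, with `s = 1`) enhanced configuration `ω̃`. -/
def fullyEnhanced (φ : Config → Config) (ω : Config) : Config :=
  ω ∪ {y | ∃ x, y ∈ enhAt φ x ω}

/-- `ω` contains a doubly-infinite self-repelling path (w.r.t. adjacency `adj`):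
a two-sided sequence of distinct sites of `ω` in which exactly the consecutive
pairs are adjacent. -/
def HasDISRPath (adj : Site → Site → Prop) (ω : Config) : Prop :=
  ∃ γ : ℤ → Site, Function.Injective γ ∧ (∀ i, γ i ∈ ω) ∧
    ∀ i j : ℤ, adj (γ i) (γ j) ↔ (j = i + 1 ∨ i = j + 1)

/-- The enhancement is essential: some configuration without a doubly-infinite
self-repelling path acquires one upon enhancement at the origin. -/
def Essential (adj : Site → Site → Prop) (φ : Config → Config) : Prop :=
  ∃ ω : Config, ¬ HasDISRPath adj ω ∧ HasDISRPath adj (ω ∪ φ ω)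

/-- A (finite, nonempty) path w.r.t. adjacency `adj`: distinct sites,
consecutive ones adjacent. -/
def IsPathOn (adj : Site → Site → Prop) (l : List Site) : Prop :=
  l ≠ [] ∧ l.Nodup ∧ l.Chain' adj

/-- `x` and `y` are joined by a path of sites of `ω`. -/
def ConnectedIn (adj : Site → Site → Prop) (ω : Config) (x y : Site) : Prop :=
  ∃ l : List Site, IsPathOn adj l ∧ (∀ z ∈ l, z ∈ ω) ∧
    l.head? = some x ∧ l.getLast? = some y

/-- `x` belongs to an infinite open cluster of `ω`. -/
def InInfiniteCluster (adj : Site → Site → Prop) (ω : Config) (x : Site) : Prop :=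
  {y | ConnectedIn adj ω x y}.Infinite

/-- `ω` contains an infinite open cluster. -/
def HasInfiniteCluster (adj : Site → Site → Prop) (ω : Config) : Prop :=
  ∃ x, InInfiniteCluster adj ω x

/-- The configuration corresponding to `η : Site → Bool`. -/
def toConfig (η : Site → Bool) : Config := {x | η x = true}

/-- A cylinder event. -/
def cylinder (F : Finset Site) (b : Site → Bool) : Set (Site → Bool) :=
  {η | ∀ x ∈ F, η x = b x}

/-- `μ` is the Bernoulli product measure with density `p` of open sites. -/
def IsBernoulli (p : ℝ) (μ : Measure (Site → Bool)) : Prop :=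
  IsProbabilityMeasure μ ∧
    ∀ (F : Finset Site) (b : Site → Bool),
      μ (cylinder F b) = ∏ x ∈ F, ENNReal.ofReal (if b x then p else 1 - p)

/-- The percolation probability `θ`: the probability that the origin lies in an
infinite open cluster. -/
noncomputable def theta (adj : Site → Site → Prop) (μ : Measure (Site → Bool)) : ℝ :=
  (μ {η | InInfiniteCluster adj (toConfig η) 0}).toReal

/-- The percolation probability of the enhanced process (`μ` the law of the
configuration, `ν` the law of the activation variables). -/
noncomputable def thetaEnh (adj : Site → Site → Prop) (φ : Config → Config)
    (μ ν : Measure (Site → Bool)) : ℝ :=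
  ((μ.prod ν) {ηα | InInfiniteCluster adj (enhanced φ (toConfig ηα.1) ηα.2) 0}).toReal

/-- The critical point `p_c = sup {p ∈ [0,1] : θ(p) = 0}` for the family `P`. -/
noncomputable def pcOf (adj : Site → Site → Prop) (P : ℝ → Measure (Site → Bool)) : ℝ :=
  sSup {p | p ∈ Icc (0:ℝ) 1 ∧ theta adj (P p) = 0}

/-- The connectivity function `τ_p(x)`. -/
noncomputable def tau (adj : Site → Site → Prop) (μ : Measure (Site → Bool)) (x : Site) : ℝ :=
  (μ {η | ConnectedIn adj (toConfig η) 0 x}).toReal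

/-- The connectivity function `τ_{p,s}(x)` of the enhanced process. -/
noncomputable def tauEnh (adj : Site → Site → Prop) (φ : Config → Config)
    (μ ν : Measure (Site → Bool)) (x : Site) : ℝ :=
  ((μ.prod ν) {ηα | ConnectedIn adj (enhanced φ (toConfig ηα.1) ηα.2) 0 x}).toReal

/-- The mean cluster size `χ(p) = E_p‖C‖ = ∑_x τ_p(x)`. -/
noncomputable def chi (adj : Site → Site → Prop) (μ : Measure (Site → Bool)) : ℝ≥0∞ :=
  ∑' x : Site, μ {η | ConnectedIn adj (toConfig η) 0 x}

/-- The mean cluster size of the enhanced process. -/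
noncomputable def chiEnh (adj : Site → Site → Prop) (φ : Config → Config)
    (μ ν : Measure (Site → Bool)) : ℝ≥0∞ :=
  ∑' x : Site, (μ.prod ν) {ηα | ConnectedIn adj (enhanced φ (toConfig ηα.1) ηα.2) 0 x}


/-! ### Adjacency, boxes and clusters -/

theorem adjZ2_iff (x y : Site) : adjZ2 x y ↔
    (x.1 = y.1 ∧ (y.2 = x.2 + 1 ∨ x.2 = y.2 + 1)) ∨
      (x.2 = y.2 ∧ (y.1 = x.1 + 1 ∨ x.1 = y.1 + 1)) := by
  unfold adjZ2
  rcases abs_cases (x.1 - y.1) with ⟨h, h'⟩ | ⟨h, h'⟩ <;>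
    rcases abs_cases (x.2 - y.2) with ⟨k, k'⟩ | ⟨k, k'⟩ <;> omega

theorem adjZ2_symm {x y : Site} (h : adjZ2 x y) : adjZ2 y x := by
  rw [adjZ2_iff] at *
  omega

/-- The box of sites with both coordinates in `[-n, n]`. -/
def box (n : ℤ) : Set Site := {x | -n ≤ x.1 ∧ x.1 ≤ n ∧ -n ≤ x.2 ∧ x.2 ≤ n}

theorem mem_box {n : ℤ} {x : Site} :
    x ∈ box n ↔ -n ≤ x.1 ∧ x.1 ≤ n ∧ -n ≤ x.2 ∧ x.2 ≤ n := Iff.rfl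

theorem box_eq (n : ℤ) : box n = Icc (-n) n ×ˢ Icc (-n) n := by
  ext x
  simp only [mem_box, mem_prod, mem_Icc]
  tauto

theorem finite_box (n : ℤ) : (box n).Finite := by
  rw [box_eq]
  exact (finite_Icc _ _).prod (finite_Icc _ _)

theorem box_mono {m n : ℤ} (h : m ≤ n) : box m ⊆ box n := by
  intro x
  simp only [mem_box]
  omega

theorem exists_box_of_finite {S : Set Site} (hS : S.Finite) (k : ℤ) : ∃ n, k ≤ n ∧ S ⊆ box n := by
  induction S, hS using Set.Finite.induction_on with
  | empty => exact ⟨k, le_rfl, empty_subset _⟩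
  | @insert a S _ _ ih =>
    obtain ⟨n, hn, h⟩ := ih
    refine ⟨max n (max |a.1| |a.2|), le_max_of_le_left hn,
      insert_subset ?_ (h.trans (box_mono (le_max_left _ _)))⟩
    have h1 := abs_le.1 (((le_max_left |a.1| |a.2|).trans (le_max_right n _)))
    have h2 := abs_le.1 (((le_max_right |a.1| |a.2|).trans (le_max_right n _)))
    exact ⟨h1.1, h1.2, h2.1, h2.2⟩

theorem exists_siteBall_subset_box (r : ℝ) : ∃ n : ℤ, siteBall r ⊆ box n := by
  refine ⟨⌈r⌉, fun x hx => ?_⟩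
  have hx : Real.sqrt ((x.1 : ℝ) ^ 2 + (x.2 : ℝ) ^ 2) ≤ r := hx
  have h1 : |(x.1 : ℝ)| ≤ r := (Real.abs_le_sqrt (by nlinarith [sq_nonneg (x.2 : ℝ)])).trans hx
  have h2 : |(x.2 : ℝ)| ≤ r := (Real.abs_le_sqrt (by nlinarith [sq_nonneg (x.1 : ℝ)])).trans hx
  have key : ∀ z : ℤ, |(z : ℝ)| ≤ r → |z| ≤ ⌈r⌉ := by
    intro z hz
    have : ((|z| : ℤ) : ℝ) ≤ (⌈r⌉ : ℤ) := by
      push_cast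
      exact hz.trans (Int.le_ceil r)
    exact_mod_cast this
  have k1 := abs_le.1 (key _ h1)
  have k2 := abs_le.1 (key _ h2)
  exact ⟨k1.1, k1.2, k2.1, k2.2⟩

/-- The nearest-neighbour graph induced by the sites of `S`. -/
def siteGraph (S : Set Site) : SimpleGraph Site where
  Adj x y := adjZ2 x y ∧ x ∈ S ∧ y ∈ S
  symm := ⟨fun _ _ h => ⟨adjZ2_symm h.1, h.2.2, h.2.1⟩⟩
  loopless := ⟨fun x h => by simp [adjZ2] at h⟩

/-- `x` and `y` are equal or joined by a path in `S`. -/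
abbrev Joined (S : Set Site) (x y : Site) : Prop := (siteGraph S).Reachable x y

theorem Joined.of_adj {S : Set Site} {x y : Site} (h : adjZ2 x y) (hx : x ∈ S) (hy : y ∈ S) :
    Joined S x y := SimpleGraph.Adj.reachable (G := siteGraph S) ⟨h, hx, hy⟩

theorem Joined.mono {S T : Set Site} (h : S ⊆ T) {x y : Site} (hxy : Joined S x y) :
    Joined T x y :=
  SimpleGraph.Reachable.mono (G := siteGraph S) (G' := siteGraph T)
    (fun _ _ h' => ⟨h'.1, h h'.2.1, h h'.2.2⟩) hxy

theorem Joined.mem_of_closed {S W : Set Site} {x y : Site} (h : Joined S x y) (hx : x ∈ W)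
    (hW : ∀ u v, u ∈ W → u ∈ S → v ∈ S → adjZ2 u v → v ∈ W) : y ∈ W := by
  rw [Joined, SimpleGraph.reachable_iff_reflTransGen] at h
  induction h with
  | refl => exact hx
  | tail _ h ih => exact hW _ _ ih h.2.1 h.2.2 h.1

theorem Joined.mem {S : Set Site} {x y : Site} (h : Joined S x y) (hx : x ∈ S) : y ∈ S :=
  h.mem_of_closed hx fun _ _ _ _ hv _ => hv

theorem Joined.map {S T : Set Site} (f : Site → Site)
    (hadj : ∀ u v, adjZ2 u v → adjZ2 (f u) (f v)) (hf : ∀ u ∈ S, f u ∈ T) {x y : Site}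
    (h : Joined S x y) : Joined T (f x) (f y) :=
  SimpleGraph.Reachable.map (G := siteGraph S) (G' := siteGraph T)
    ⟨f, fun {u v} h' => ⟨hadj u v h'.1, hf _ h'.2.1, hf _ h'.2.2⟩⟩ h

theorem Joined.vertical {S : Set Site} {s p q : ℤ} (hpq : p ≤ q)
    (h : ∀ t, p ≤ t → t ≤ q → (s, t) ∈ S) : Joined S (s, p) (s, q) := by
  induction q, hpq using Int.leInduction with
  | base => exact SimpleGraph.Reachable.refl _
  | succ n hn ih =>
    exact (ih fun t h1 h2 => h t h1 (by omega)).trans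
      (Joined.of_adj (by simp [adjZ2]) (h _ hn (by omega)) (h _ (by omega) le_rfl))

theorem Joined.horizontal {S : Set Site} {s p q : ℤ} (hpq : p ≤ q)
    (h : ∀ t, p ≤ t → t ≤ q → (t, s) ∈ S) : Joined S (p, s) (q, s) := by
  induction q, hpq using Int.leInduction with
  | base => exact SimpleGraph.Reachable.refl _
  | succ n hn ih =>
    exact (ih fun t h1 h2 => h t h1 (by omega)).trans
      (Joined.of_adj (by simp [adjZ2]) (h _ hn (by omega)) (h _ (by omega) le_rfl))

theorem connectedIn_iff {S : Set Site} {x y : Site} :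
    ConnectedIn adjZ2 S x y ↔ x ∈ S ∧ Joined S x y := by
  constructor
  · rintro ⟨l, ⟨-, -, hl⟩, hS, hx, hy⟩
    induction l generalizing x with
    | nil => simp at hx
    | cons u l ih =>
      obtain rfl : u = x := by simpa using hx
      refine ⟨hS _ (by simp), ?_⟩
      cases l with
      | nil =>
        obtain rfl : u = y := by simpa using hy
        exact SimpleGraph.Reachable.refl _
      | cons v l =>
        have hl' := List.isChain_cons_cons.1 hl
        have := ih hl'.2 (fun z hz => hS z (by simp [hz])) (x := v) (by simp) (by simpa using hy)
        exact (Joined.of_adj hl'.1 (hS _ (by simp)) (hS _ (by simp))).trans this.2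
  · rintro ⟨hx, h⟩
    obtain ⟨p, hp⟩ := h.exists_isPath
    refine ⟨p.support, ⟨p.support_ne_nil, hp.support_nodup, ?_⟩, ?_, ?_, ?_⟩
    · exact p.isChain_adj_support.imp fun _ _ h => h.1
    · intro z hz
      exact Joined.mem (p.takeUntil z hz).reachable hx
    · rw [List.head?_eq_some_head p.support_ne_nil, p.head_support]
    · rw [List.getLast?_eq_some_getLast p.support_ne_nil, p.getLast_support]

theorem not_hasInfiniteCluster_iff {S : Set Site} :
    ¬ HasInfiniteCluster adjZ2 S ↔ ∀ x, {y | Joined S x y}.Finite := by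
  simp only [HasInfiniteCluster, InInfiniteCluster, not_exists, not_infinite, connectedIn_iff]
  refine forall_congr' fun x => ⟨fun h => ?_, fun h => h.subset fun y hy => hy.2⟩
  by_cases hx : x ∈ S
  · simpa [hx] using h
  · refine (finite_singleton x).subset fun y hy => ?_
    exact Joined.mem_of_closed (W := {x}) hy rfl fun u v hu hu' => absurd (hu ▸ hu') hx

/-! ### Doubly-infinite self-repelling paths -/

/-- Joined sites are joined by an induced path. -/
theorem Joined.exists_induced_path {S : Set Site} {a b : Site} (h : Joined S a b) (ha : a ∈ S) :
    ∃ (L : ℕ) (p : ℕ → Site), p 0 = a ∧ p L = b ∧ (∀ i ≤ L, p i ∈ S) ∧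
      (∀ i < L, adjZ2 (p i) (p (i + 1))) ∧
      ∀ i j, i < j → j ≤ L → p i ≠ p j ∧ (adjZ2 (p i) (p j) → j = i + 1) := by
  obtain ⟨w, hw⟩ := h.exists_walk_length_eq_dist
  have hmem : ∀ i, w.getVert i ∈ S := fun i => Joined.mem (w.take i).reachable ha
  have key : ∀ i j, i ≤ j → j ≤ w.length → ∀ q : (siteGraph S).Walk (w.getVert i) (w.getVert j),
      j ≤ i + q.length := by
    intro i j hij hj q
    have h1 := SimpleGraph.dist_le (((w.take i).append q).append (w.drop j))
    simp only [SimpleGraph.Walk.length_append, SimpleGraph.Walk.take_length,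
      SimpleGraph.Walk.drop_length] at h1
    omega
  refine ⟨w.length, w.getVert, by simp, by simp, fun i _ => hmem i,
    fun i hi => (w.adj_getVert_succ hi).1, fun i j hij hj => ⟨fun he => ?_, fun hadj => ?_⟩⟩
  · have := key i j hij.le hj (SimpleGraph.Walk.nil.copy rfl he)
    simp at this
    omega
  · have h' : (siteGraph S).Adj (w.getVert i) (w.getVert j) := ⟨hadj, hmem i, hmem j⟩
    have := key i j hij.le hj h'.toWalk
    simp at this
    omega

/-- Two induced rays attached to joined sites of `S`, and otherwise not touching `S` nor each
other, give rise to a doubly-infinite self-repelling path. -/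
theorem hasDISRPath_of_rays {S T : Set Site} {ρ σ : ℕ → Site} (hST : S ⊆ T)
    (hρT : ∀ k, ρ k ∈ T) (hσT : ∀ k, σ k ∈ T) (ha : ρ 0 ∈ S) (hab : Joined S (ρ 0) (σ 0))
    (hρ : ∀ i j, i < j → ρ i ≠ ρ j ∧ (adjZ2 (ρ i) (ρ j) ↔ j = i + 1))
    (hσ : ∀ i j, i < j → σ i ≠ σ j ∧ (adjZ2 (σ i) (σ j) ↔ j = i + 1))
    (hρσ : ∀ i j, 0 < i → 0 < j → ρ i ≠ σ j ∧ ¬ adjZ2 (ρ i) (σ j))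
    (hρS : ∀ k, 0 < k → ∀ z ∈ S, ρ k ≠ z ∧ (adjZ2 (ρ k) z → k = 1 ∧ z = ρ 0))
    (hσS : ∀ k, 0 < k → ∀ z ∈ S, z ≠ σ k ∧ (adjZ2 z (σ k) → k = 1 ∧ z = σ 0)) :
    HasDISRPath adjZ2 T := by
  obtain ⟨L, p, hp0, hpL, hpS, hpadj, hp⟩ := hab.exists_induced_path ha
  let γ : ℤ → Site := fun i =>
    if i < 0 then ρ (-i).toNat else if i ≤ L then p i.toNat else σ (i - L).toNat
  have hneg : ∀ i : ℤ, i < 0 → γ i = ρ (-i).toNat := fun i hi => if_pos hi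
  have hmid : ∀ i : ℤ, 0 ≤ i → i ≤ L → γ i = p i.toNat := fun i hi hL =>
    (if_neg hi.not_gt).trans (if_pos hL)
  have hright : ∀ i : ℤ, L < i → γ i = σ (i - L).toNat := fun i hL =>
    (if_neg (by omega)).trans (if_neg hL.not_ge)
  have key : ∀ i j : ℤ, i < j → γ i ≠ γ j ∧ (adjZ2 (γ i) (γ j) ↔ j = i + 1) := by
    intro i j hij
    rcases lt_or_ge i 0 with hi | hi
    · have hγi := hneg i (by omega)
      rcases lt_or_ge j 0 with hj | hj
      · have hγj := hneg j (by omega)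
        rw [hγi, hγj]
        obtain ⟨h1, h2⟩ := hρ (-j).toNat (-i).toNat (by omega)
        refine ⟨h1.symm, ?_⟩
        rw [show adjZ2 (ρ (-i).toNat) (ρ (-j).toNat) ↔ _ from
          ⟨adjZ2_symm, adjZ2_symm⟩, h2]
        omega
      rcases le_or_gt j L with hjL | hjL
      · have hγj := hmid j (by omega) (by omega)
        rw [hγi, hγj]
        obtain ⟨h1, h2⟩ := hρS (-i).toNat (by omega) (p j.toNat) (hpS _ (by omega))
        refine ⟨h1, fun h => ?_, fun h => ?_⟩
        · obtain ⟨h3, h4⟩ := h2 h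
          have : ¬ 0 < j.toNat := fun hpos => (hp 0 j.toNat hpos (by omega)).1 (hp0.trans h4.symm)
          omega
        · obtain rfl : i = -1 := by omega
          obtain rfl : j = 0 := by omega
          simp only [Int.toNat_zero, hp0]
          exact adjZ2_symm ((hρ 0 1 one_pos).2.2 rfl)
      · have hγj := hright j (by omega)
        rw [hγi, hγj]
        obtain ⟨h1, h2⟩ := hρσ (-i).toNat (j - L).toNat (by omega) (by omega)
        exact ⟨h1, fun h => absurd h h2, fun h => by omega⟩
    rcases le_or_gt i L with hiL | hiL
    · have hγi := hmid i (by omega) (by omega)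
      rcases le_or_gt j L with hjL | hjL
      · have hγj := hmid j (by omega) (by omega)
        rw [hγi, hγj]
        obtain ⟨h1, h2⟩ := hp i.toNat j.toNat (by omega) (by omega)
        refine ⟨h1, fun h => by have := h2 h; omega, fun h => ?_⟩
        rw [show j.toNat = i.toNat + 1 by omega]
        exact hpadj _ (by omega)
      · have hγj := hright j (by omega)
        rw [hγi, hγj]
        obtain ⟨h1, h2⟩ := hσS (j - L).toNat (by omega) (p i.toNat) (hpS _ (by omega))
        refine ⟨h1, fun h => ?_, fun h => ?_⟩
        · obtain ⟨h3, h4⟩ := h2 h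
          have : ¬ i.toNat < L := fun hlt => (hp i.toNat L hlt le_rfl).1 (h4.trans hpL.symm)
          omega
        · rw [show i.toNat = L by omega, show (j - L).toNat = 1 by omega, hpL]
          exact (hσ 0 1 one_pos).2.2 rfl
    · have hγi := hright i (by omega)
      have hγj := hright j (by omega)
      rw [hγi, hγj]
      obtain ⟨h1, h2⟩ := hσ (i - L).toNat (j - L).toNat (by omega)
      refine ⟨h1, h2.trans ?_⟩
      omega
  refine ⟨γ, fun i j hij => ?_, fun i => ?_, fun i j => ?_⟩
  · rcases lt_trichotomy i j with h | h | h
    · exact absurd hij (key i j h).1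
    · exact h
    · exact absurd hij.symm (key j i h).1
  · dsimp only [γ]
    split_ifs with h1 h2
    · exact hρT _
    · exact hST (hpS _ (by omega))
    · exact hσT _
  · rcases lt_trichotomy i j with h | h | h
    · rw [(key i j h).2]
      omega
    · subst h
      simp [adjZ2]
    · rw [show adjZ2 (γ i) (γ j) ↔ _ from ⟨adjZ2_symm, adjZ2_symm⟩, (key j i h).2]
      omega

theorem exists_eq_of_step {g : ℕ → ℤ} (hg : ∀ n, g n - 1 ≤ g (n + 1)) {K : ℤ} (hK : K ≤ g 0)
    (hn : ∃ n, g n < K) : ∃ n, g n = K := by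
  classical
  have hn' : ∃ n, g n ≤ K := hn.imp fun _ h => h.le
  refine ⟨Nat.find hn', (Nat.find_spec hn').antisymm ?_⟩
  rcases h : Nat.find hn' with _ | m
  · exact hK
  · have h1 := Nat.find_min hn' (m := m) (by omega)
    have h2 := hg m
    omega

/-- A set which, up to finitely many sites, is a single ray contains no injective doubly-infinite
path. -/
theorem not_injective_of_single_end {S : Set Site} (f : Site → ℤ)
    (hf : ∀ u v, adjZ2 u v → f u - 1 ≤ f v) (hfin : ∀ K, {z ∈ S | K ≤ f z}.Finite) (K₀ : ℤ)
    (hinj : ∀ z ∈ S, ∀ w ∈ S, f z = f w → f z ≤ K₀ → z = w) (γ : ℤ → Site)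
    (hγS : ∀ i, γ i ∈ S) (hadj : ∀ i, adjZ2 (γ i) (γ (i + 1))) : ¬ Function.Injective γ := by
  intro hγ
  have unbdd : ∀ e : ℕ → ℤ, Function.Injective e → ∀ K, ∃ n, f (γ (e n)) < K := by
    intro e he K
    by_contra! h
    exact infinite_of_injective_forall_mem (s := {z ∈ S | K ≤ f z}) (hγ.comp he)
      (fun n => ⟨hγS _, h n⟩) (hfin K)
  let K := min K₀ (min (f (γ 0)) (f (γ (-1))))
  obtain ⟨n, hn⟩ := exists_eq_of_step (g := fun n : ℕ => f (γ n)) (K := K)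
    (fun n => hf _ _ (by simpa using hadj n)) (by simp [K])
    (unbdd (fun n => n) Nat.cast_injective K)
  obtain ⟨m, hm⟩ := exists_eq_of_step (g := fun n : ℕ => f (γ (-1 - n))) (K := K)
    (fun n => hf _ _ (by
      have := adjZ2_symm (hadj (-1 - (n + 1 : ℕ)))
      rwa [show (-1 - ((n + 1 : ℕ) : ℤ)) + 1 = -1 - n by push_cast; ring] at this))
    (by simp [K])
    (unbdd (fun n => -1 - n) (fun a b h => by simpa using h) K)
  have := hγ (hinj _ (hγS _) _ (hγS _) (hn.trans hm.symm) (hn.le.trans (min_le_left _ _)))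
  omega

/-! ### Local pivotality -/

/-- There is a configuration in a box having exactly two boundary sites, which are not joined,
but become joined after the enhancement at the origin. -/
def LocallyPivotal (r : ℝ) (φ : Config → Config) : Prop :=
  ∃ (N : ℤ) (ζ : Set Site) (a b : Site), siteBall r ⊆ box (N - 1) ∧ ζ ⊆ box N ∧ a ∈ ζ ∧ b ∈ ζ ∧
    a ∉ box (N - 1) ∧ b ∉ box (N - 1) ∧ (∀ z ∈ ζ, z ∉ box (N - 1) → z = a ∨ z = b) ∧
    ¬ Joined ζ a b ∧ Joined (ζ ∪ φ ζ) a b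

theorem IsEnhancement.congr {r : ℝ} {φ : Config → Config} (hφ : IsEnhancement r φ)
    {ω ω' : Config} (h : ∀ z ∈ siteBall r, z ∈ ω ↔ z ∈ ω') : φ ω = φ ω' := by
  refine hφ.2.2 _ _ ?_
  ext z
  simp only [mem_inter_iff, and_congr_left_iff]
  exact h z

theorem mem_box_add_one_of_adj {n : ℤ} {u v : Site} (h : adjZ2 u v) (hu : u ∈ box n) :
    v ∈ box (n + 1) := by
  rw [adjZ2_iff] at h
  rw [mem_box] at *
  omega

theorem exists_first_exit {g : ℕ → Site} (hg : Function.Injective g)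
    (hadj : ∀ i, adjZ2 (g i) (g (i + 1))) {n : ℤ} (K : ℕ) (hK : ∀ i ≤ K, g i ∈ box n) :
    ∃ m, K < m ∧ g m ∉ box n ∧ g m ∈ box (n + 1) ∧ ∀ i < m, g i ∈ box n := by
  classical
  have hex : ∃ m, g m ∉ box n := by
    by_contra! h
    exact infinite_of_injective_forall_mem hg h (finite_box n)
  have hm := Nat.find_spec hex
  have hlt : K < Nat.find hex := by
    by_contra! h
    exact hm (hK _ h)
  refine ⟨Nat.find hex, hlt, hm, ?_, fun i hi => by simpa using Nat.find_min hex hi⟩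
  have h1 : g (Nat.find hex - 1) ∈ box n := by
    simpa using Nat.find_min hex (m := Nat.find hex - 1) (by omega)
  have h2 := hadj (Nat.find hex - 1)
  rw [Nat.sub_add_cancel (by omega)] at h2
  exact mem_box_add_one_of_adj h2 h1

theorem joined_of_consecutive {S : Set Site} {γ : ℤ → Site} (hadj : ∀ i, adjZ2 (γ i) (γ (i + 1)))
    {p q : ℤ} (hpq : p ≤ q) (h : ∀ i, p ≤ i → i ≤ q → γ i ∈ S) : Joined S (γ p) (γ q) := by
  induction q, hpq using Int.leInduction with
  | base => exact SimpleGraph.Reachable.refl _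
  | succ n hn ih =>
    exact (ih fun t h1 h2 => h t h1 (by omega)).trans
      (Joined.of_adj (hadj n) (h _ hn (by omega)) (h _ (by omega) le_rfl))

theorem LocallyPivotal.of_essential {r : ℝ} {φ : Config → Config} (hφ : IsEnhancement r φ)
    (hess : Essential adjZ2 φ) : LocallyPivotal r φ := by
  obtain ⟨ω, hω, γ, hγ, hγω, hγadj⟩ := hess
  obtain ⟨R, hR⟩ := exists_siteBall_subset_box r
  have hsucc : ∀ i, adjZ2 (γ i) (γ (i + 1)) := fun i => (hγadj i _).2 (Or.inl rfl)
  have hout : ∀ i, γ i ∉ box R → γ i ∈ ω := fun i hi =>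
    (hγω i).resolve_right fun h => hi (hR (hφ.2.1 _ h))
  have hI : (γ ⁻¹' box (R + 1)).Finite := (finite_box _).preimage hγ.injOn
  obtain ⟨K, hK⟩ : ∃ K : ℕ, ∀ i, γ i ∈ box (R + 1) → -(K : ℤ) ≤ i ∧ i ≤ K := by
    obtain ⟨u, hu⟩ := hI.bddAbove
    obtain ⟨l, hl⟩ := hI.bddBelow
    refine ⟨u.natAbs + l.natAbs, fun i hi => ?_⟩
    have h1 := hu hi
    have h2 := hl hi
    omega
  obtain ⟨n, hn, hnγ⟩ := exists_box_of_finite ((finite_Icc (-(K : ℤ)) K).image γ) (R + 1)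
  have hfar : ∀ i : ℤ, (i < -K ∨ K < i) → γ i ∉ box (R + 1) := fun i hi h => by
    have := hK i h
    omega
  obtain ⟨m, hKm, hm, hm', hmlt⟩ := exists_first_exit (g := fun i : ℕ => γ i) (n := n)
    (fun i j h => by simpa using hγ h) (fun i => by simpa using hsucc i) K
    (fun i hi => hnγ ⟨i, ⟨by omega, by omega⟩, rfl⟩)
  obtain ⟨k, hKk, hk, hk', hklt⟩ := exists_first_exit (g := fun i : ℕ => γ (-i)) (n := n)
    (fun i j h => by simpa using hγ h)
    (fun i => (hγadj _ _).2 (Or.inr (by push_cast; ring))) K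
    (fun i hi => hnγ ⟨-i, ⟨by omega, by omega⟩, rfl⟩)
  have hbetween : ∀ i : ℤ, -k < i → i < m → γ i ∈ box n := by
    intro i h1 h2
    rcases le_total 0 i with h | h
    · simpa [h] using hmlt i.toNat (by omega)
    · simpa [h] using hklt (-i).toNat (by omega)
  have hRn : box R ⊆ box n := box_mono (by omega)
  set ζ : Set Site := (ω ∩ box R) ∪ {z | ∃ i, -(k : ℤ) ≤ i ∧ i ≤ m ∧ γ i = z ∧ z ∉ box R} with hζ
  have hφζ : φ ζ = φ ω := hφ.congr fun z hz => by
    have := hR hz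
    simp [hζ, this]
  have haR : γ (-k) ∉ box R := fun h => hk (hRn h)
  have hbR : γ m ∉ box R := fun h => hm (hRn h)
  have haζ : γ (-k) ∈ ζ := Or.inr ⟨-k, le_rfl, by omega, rfl, haR⟩
  have hbζ : γ m ∈ ζ := Or.inr ⟨m, by omega, le_rfl, rfl, hbR⟩
  have hζω : ζ ⊆ ω := by
    rintro z (hz | ⟨i, -, -, rfl, hz⟩)
    · exact hz.1
    · exact hout i hz
  refine ⟨n + 1, ζ, γ (-k), γ m, ?_, ?_, haζ, hbζ, ?_, ?_, ?_, fun hj => hω ?_, ?_⟩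
  · simpa using hR.trans hRn
  · rintro z (hz | ⟨i, h1, h2, rfl, -⟩)
    · exact box_mono (by omega) hz.2
    · rcases h1.eq_or_lt with rfl | h1
      · exact hk'
      rcases h2.eq_or_lt with rfl | h2
      · exact hm'
      exact box_mono (by omega) (hbetween i h1 h2)
  · simpa using hk
  · simpa using hm
  · rw [add_sub_cancel_right]
    rintro z (hz | ⟨i, h1, h2, rfl, -⟩) hz'
    · exact absurd (hRn hz.2) hz'
    · rcases h1.eq_or_lt with rfl | h1
      · exact Or.inl rfl
      rcases h2.eq_or_lt with rfl | h2
      · exact Or.inr rfl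
      exact absurd (hbetween i h1 h2) hz'
  · have hfarω : ∀ i : ℤ, (i < -K ∨ K < i) → γ i ∈ ω := fun i hi =>
      hout i fun h => hfar i hi (box_mono (by omega) h)
    have houter : ∀ i : ℤ, (i < -k ∨ m < i) → ∀ z ∈ ζ, γ i ≠ z ∧
        (adjZ2 (γ i) z → (i = -k - 1 ∧ z = γ (-k)) ∨ (i = m + 1 ∧ z = γ m)) := by
      intro i hi z hz
      have hiR := hfar i (by omega)
      rcases hz with hz | ⟨j, h1, h2, rfl, -⟩
      · refine ⟨fun h => hiR (box_mono (by omega) (h ▸ hz.2)), fun h => ?_⟩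
        exact absurd (mem_box_add_one_of_adj (adjZ2_symm h) hz.2) hiR
      · refine ⟨fun h => by have := hγ h; omega, fun h => ?_⟩
        rcases (hγadj i j).1 h with h | h
        · obtain rfl : j = -k := by omega
          exact Or.inl ⟨by omega, rfl⟩
        · obtain rfl : j = m := by omega
          exact Or.inr ⟨by omega, rfl⟩
    refine hasDISRPath_of_rays (ρ := fun i => γ (-k - i)) (σ := fun i => γ (m + i)) hζω
      (fun i => hfarω _ (by omega)) (fun i => hfarω _ (by omega)) (by simpa using haζ)
      (by simpa using hj) ?_ ?_ ?_ ?_ ?_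
    · intro i j hij
      exact ⟨fun h => by have := hγ h; omega, by rw [hγadj]; omega⟩
    · intro i j hij
      exact ⟨fun h => by have := hγ h; omega, by rw [hγadj]; omega⟩
    · intro i j hi hj
      exact ⟨fun h => by have := hγ h; omega, by rw [hγadj]; omega⟩
    · intro i hi z hz
      obtain ⟨h1, h2⟩ := houter (-k - i) (by omega) z hz
      refine ⟨h1, fun h => ?_⟩
      rcases h2 h with ⟨h3, h4⟩ | ⟨h3, h4⟩
      · exact ⟨by omega, by simpa using h4⟩
      · omega
    · intro i hi z hz
      obtain ⟨h1, h2⟩ := houter (m + i) (by omega) z hz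
      refine ⟨h1.symm, fun h => ?_⟩
      rcases h2 (adjZ2_symm h) with ⟨h3, h4⟩ | ⟨h3, h4⟩
      · omega
      · exact ⟨by omega, by simpa using h4⟩
  · rw [hφζ]
    refine joined_of_consecutive hsucc (by omega) fun i h1 h2 => ?_
    by_cases hi : γ i ∈ box R
    · exact (hγω i).imp (fun h => Or.inl ⟨h, hi⟩) id
    · exact Or.inl (Or.inr ⟨i, h1, h2, rfl, hi⟩)

/-! ### No infinite cluster is created without local pivotality -/

theorem joined_of_not_locallyPivotal {r : ℝ} {φ : Config → Config} (hφ : IsEnhancement r φ)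
    (hlp : ¬ LocallyPivotal r φ) {R : ℤ} (hR : siteBall r ⊆ box R) {ω : Config} {a b : Site}
    (ha : a ∈ ω) (hb : b ∈ ω) (haR : a ∉ box R) (hbR : b ∉ box R) (haR' : a ∈ box (R + 1))
    (hbR' : b ∈ box (R + 1)) (h : Joined (((ω ∪ φ ω) ∩ box R) ∪ {a, b}) a b) :
    Joined ω a b := by
  by_contra hab
  set ζ : Set Site := (ω ∩ box R) ∪ {a, b} with hζ
  have hζω : ζ ⊆ ω := union_subset inter_subset_left (by simp [insert_subset_iff, ha, hb])
  have hφζ : φ ζ = φ ω := hφ.congr fun z hz => by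
    have hz := hR hz
    have h1 : z ≠ a := fun h => haR (h ▸ hz)
    have h2 : z ≠ b := fun h => hbR (h ▸ hz)
    simp [hζ, hz, h1, h2]
  refine hlp ⟨R + 1, ζ, a, b, ?_⟩
  rw [add_sub_cancel_right]
  refine ⟨hR, ?_, by simp [hζ], by simp [hζ], haR, hbR, ?_, fun h' => hab (h'.mono hζω),
    h.mono ?_⟩
  · refine union_subset (inter_subset_right.trans (box_mono (by omega))) ?_
    simp [insert_subset_iff, haR', hbR']
  · rintro z (hz | hz) hz'
    · exact absurd hz.2 hz'
    · simpa using hz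
  · rw [hφζ]
    rintro z (⟨hz | hz, hzR⟩ | hz)
    · exact Or.inl (Or.inl ⟨hz, hzR⟩)
    · exact Or.inr hz
    · exact Or.inl (Or.inr hz)

theorem joined_enhanced_of_not_locallyPivotal {r : ℝ} {φ : Config → Config}
    (hφ : IsEnhancement r φ) (hlp : ¬ LocallyPivotal r φ) {R : ℤ} (hR : siteBall r ⊆ box R)
    {ω : Config} {y z : Site} (hy : y ∈ ω) (hyR : y ∉ box R) (h : Joined (ω ∪ φ ω) y z) :
    z ∈ box R ∨ Joined ω y z := by
  have hsub : ∀ {z}, z ∈ ω ∪ φ ω → z ∉ box R → z ∈ ω := fun hz hzR =>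
    hz.resolve_right fun h => hzR (hR (hφ.2.1 _ h))
  let W : Set Site := {z | (z ∉ box R ∧ Joined ω y z) ∨ (z ∈ box R ∧ ∃ w, w ∉ box R ∧
    w ∈ box (R + 1) ∧ Joined ω y w ∧ Joined (((ω ∪ φ ω) ∩ box R) ∪ {w}) w z)}
  have hzW : z ∈ W := by
    refine h.mem_of_closed (W := W) (Or.inl ⟨hyR, SimpleGraph.Reachable.refl _⟩) ?_
    rintro u v hu huω hvω huv
    by_cases hv : v ∈ box R
    · right
      rcases hu with ⟨huR, hu⟩ | ⟨huR, w, hw, hw', hyw, hwu⟩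
      · exact ⟨hv, u, huR, mem_box_add_one_of_adj (adjZ2_symm huv) hv, hu,
          Joined.of_adj huv (by simp) (Or.inl ⟨hvω, hv⟩)⟩
      · exact ⟨hv, w, hw, hw', hyw,
          hwu.trans (Joined.of_adj huv (Or.inl ⟨huω, huR⟩) (Or.inl ⟨hvω, hv⟩))⟩
    · left
      have hvω' := hsub hvω hv
      rcases hu with ⟨huR, hu⟩ | ⟨huR, w, hw, hw', hyw, hwu⟩
      · exact ⟨hv, hu.trans (Joined.of_adj huv (hsub huω huR) hvω')⟩
      · refine ⟨hv, hyw.trans (joined_of_not_locallyPivotal hφ hlp hR (hyw.mem hy) hvω' hw hv hw'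
          (mem_box_add_one_of_adj huv huR) ?_)⟩
        refine (hwu.mono (union_subset_union_right _ (by simp))).trans
          (Joined.of_adj huv (Or.inl ⟨huω, huR⟩) (by simp))
  rcases hzW with h | h
  · exact Or.inr h.2
  · exact Or.inl h.1

theorem adjZ2_add {u v : Site} (x : Site) (h : adjZ2 u v) : adjZ2 (u + x) (v + x) := by
  simpa [adjZ2] using h

theorem adjZ2_sub {u v : Site} (x : Site) (h : adjZ2 u v) : adjZ2 (u - x) (v - x) := by
  simpa [adjZ2] using h

theorem finite_cluster_union_enhAt {r : ℝ} {φ : Config → Config}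
    (hφ : IsEnhancement r φ) (hlp : ¬ LocallyPivotal r φ) {R : ℤ} (hR : siteBall r ⊆ box R)
    {ω : Config} {x y : Site} (hy : y ∈ ω) (hyR : y - x ∉ box R)
    (hfin : {z | Joined ω y z}.Finite) : {z | Joined (ω ∪ enhAt φ x ω) y z}.Finite := by
  refine (((finite_box R).image fun z => z + x).union hfin).subset fun z hz => ?_
  have h1 : Joined (shiftConfig x ω ∪ φ (shiftConfig x ω)) (y - x) (z - x) := by
    refine Joined.map (fun u => u - x) (fun _ _ => adjZ2_sub x) ?_ hz
    rintro u (hu | ⟨v, hv, rfl⟩)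
    · exact Or.inl (by simpa [shiftConfig] using hu)
    · exact Or.inr (by simpa using hv)
  rcases joined_enhanced_of_not_locallyPivotal hφ hlp hR (by simpa [shiftConfig] using hy) hyR h1
    with h | h
  · exact Or.inl ⟨_, h, by simp⟩
  · right
    have := h.map (T := ω) (fun u => u + x) (fun _ _ => adjZ2_add x) (fun u hu => hu)
    simpa using this

theorem enhAt_mono {φ : Config → Config} (hmono : Monotonic φ) (x : Site) {ω ω' : Config}
    (h : ω ⊆ ω') : enhAt φ x ω ⊆ enhAt φ x ω' :=
  image_mono (hmono _ _ fun _ hz => h hz)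

theorem exists_finite_cluster_of_finite {r : ℝ} {φ : Config → Config}
    (hφ : IsEnhancement r φ) (hmono : Monotonic φ) (hlp : ¬ LocallyPivotal r φ) {R : ℤ}
    (hR : siteBall r ⊆ box R) {ω : Config} {y : Site} (hy : y ∈ ω)
    (hfin : {z | Joined ω y z}.Finite) {F : Set Site} (hF : F.Finite)
    (hFy : ∀ x ∈ F, y - x ∉ box R) :
    ∃ ω', ω ⊆ ω' ∧ (∀ x ∈ F, enhAt φ x ω ⊆ ω') ∧ {z | Joined ω' y z}.Finite := by
  induction F, hF using Set.Finite.induction_on with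
  | empty => exact ⟨ω, Subset.rfl, by simp, hfin⟩
  | @insert x F _ _ ih =>
    obtain ⟨ω', h1, h2, h3⟩ := ih fun x hx => hFy x (mem_insert_of_mem _ hx)
    refine ⟨ω' ∪ enhAt φ x ω', h1.trans subset_union_left, fun x' hx' => ?_,
      finite_cluster_union_enhAt hφ hlp hR (h1 hy) (hFy x (mem_insert _ _)) h3⟩
    rcases mem_insert_iff.1 hx' with rfl | hx'
    · exact (enhAt_mono hmono _ h1).trans subset_union_right
    · exact (h2 x' hx').trans subset_union_left

theorem finite_cluster_union_finite {ω F : Set Site} (hω : ∀ x, {y | Joined ω x y}.Finite)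
    (hF : F.Finite) (x : Site) : {y | Joined (ω ∪ F) x y}.Finite := by
  have hU : ({x} ∪ {u | ∃ f ∈ F, adjZ2 f u}).Finite := by
    refine (finite_singleton x).union
      ((hF.biUnion fun f _ => (finite_box 1).image fun z => z + f).subset ?_)
    rintro u ⟨f, hf, hfu⟩
    refine mem_biUnion hf ⟨u - f, ?_, by simp⟩
    rw [adjZ2_iff] at hfu
    simp only [mem_box, Prod.fst_sub, Prod.snd_sub]
    omega
  refine (hF.union (hU.biUnion fun u _ => hω u)).subset fun z hz => ?_
  refine Joined.mem_of_closed hz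
    (Or.inr (mem_biUnion (Or.inl rfl) (SimpleGraph.Reachable.refl _))) ?_
  rintro u v hu huω (hv | hv) huv
  · by_cases huF : u ∈ F
    · exact Or.inr (mem_biUnion (Or.inr ⟨u, huF, huv⟩) (SimpleGraph.Reachable.refl _))
    · rcases hu with hu | hu
      · exact absurd hu huF
      · obtain ⟨w, hw, hwu⟩ := mem_iUnion₂.1 hu
        exact Or.inr (mem_biUnion hw
          (SimpleGraph.Reachable.trans hwu (Joined.of_adj huv (huω.resolve_right huF) hv)))
  · exact Or.inl hv

theorem LocallyPivotal.of_hasInfiniteCluster {r : ℝ} {φ : Config → Config}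
    (hφ : IsEnhancement r φ) (hmono : Monotonic φ) {ω : Config} {α : Site → Bool}
    (hω : ¬ HasInfiniteCluster adjZ2 ω) (hinf : HasInfiniteCluster adjZ2 (enhanced φ ω α)) :
    LocallyPivotal r φ := by
  by_contra hlp
  rw [not_hasInfiniteCluster_iff] at hω
  refine absurd hinf (not_hasInfiniteCluster_iff.2 fun y => ?_)
  by_cases hy : y ∈ enhanced φ ω α
  swap
  · refine (finite_singleton y).subset fun z hz => ?_
    exact Joined.mem_of_closed (W := {y}) hz rfl fun u v hu hu' => absurd (hu ▸ hu') hy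
  obtain ⟨R, hR⟩ := exists_siteBall_subset_box r
  have henh : ∀ {x z ω}, z ∈ enhAt φ x ω → z - x ∈ box R := by
    rintro x z ω ⟨v, hv, rfl⟩
    simpa using hR (hφ.2.1 _ hv)
  set F : Set Site := {z | ∃ x, y - x ∈ box R ∧ z ∈ enhAt φ x ω} with hFdef
  have hF : F.Finite := by
    refine (finite_box (R + R)).image (fun z => z + y) |>.subset ?_
    rintro z ⟨x, hx, hz⟩
    refine ⟨z - y, ?_, by simp⟩
    have := henh hz
    simp only [mem_box, Prod.fst_sub, Prod.snd_sub] at *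
    omega
  have hyF : y ∈ ω ∪ F := hy.imp id fun ⟨x, _, hx⟩ => ⟨x, henh hx, hx⟩
  have hC := finite_cluster_union_finite hω hF y
  obtain ⟨m, -, hm⟩ := exists_box_of_finite hC 0
  set ω₂ : Set Site := ω ∪ F ∪ (box (m + 1))ᶜ with hω₂
  have hω₂fin : {z | Joined ω₂ y z}.Finite := by
    refine hC.subset fun z hz => Joined.mem_of_closed hz (SimpleGraph.Reachable.refl _) ?_
    intro u v hu _ hv huv
    have hvm : v ∈ box (m + 1) := mem_box_add_one_of_adj huv (hm hu)
    have hu' : Joined (ω ∪ F) y u := hu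
    exact hu'.trans (Joined.of_adj huv (hu'.mem hyF) (hv.resolve_right fun h => h hvm))
  obtain ⟨ω', h1, h2, h3⟩ := exists_finite_cluster_of_finite hφ hmono hlp hR (Or.inl hyF) hω₂fin
    ((finite_box (m + 1 + R)).subset (sep_subset _ fun x => y - x ∉ box R)) fun x hx => hx.2
  refine h3.subset fun z hz => Joined.mono ?_ hz
  rintro v (hv | ⟨x, -, hv⟩)
  · exact h1 (Or.inl (Or.inl hv))
  · by_cases hxy : y - x ∈ box R
    · exact h1 (Or.inl (Or.inr ⟨x, hxy, hv⟩))
    by_cases hxm : x ∈ box (m + 1 + R)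
    · exact h2 x ⟨hxm, hxy⟩ (enhAt_mono hmono x (fun z hz => Or.inl (Or.inl hz)) hv)
    · refine h1 (Or.inr fun hvm => hxm ?_)
      have := henh hv
      simp only [mem_box, Prod.fst_sub, Prod.snd_sub] at *
      omega

/-! ### Reflections of the lattice -/

/-- An additive involution of the lattice preserving adjacency, boxes and the Euclidean norm. -/
structure IsReflection (T : Site → Site) : Prop where
  invol : ∀ x, T (T x) = x
  map_add : ∀ x y, T (x + y) = T x + T y
  adj : ∀ x y, adjZ2 x y → adjZ2 (T x) (T y)
  norm : ∀ x, siteNorm (T x) = siteNorm x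
  box : ∀ n x, x ∈ box n → T x ∈ box n

theorem exists_isReflection {N : ℤ} {b : Site} (hb : b ∈ box N) (hb' : b ∉ box (N - 1)) :
    ∃ T, IsReflection T ∧ (T b).1 = N := by
  have hcase : b.1 = N ∨ b.1 = -N ∨ b.2 = N ∨ b.2 = -N := by
    rw [mem_box] at *
    omega
  rcases hcase with h | h | h | h
  · exact ⟨id, ⟨fun _ => rfl, fun _ _ => rfl, fun _ _ => id, fun _ => rfl, fun _ _ => id⟩, h⟩
  · refine ⟨fun x => (-x.1, x.2), ⟨fun x => by simp, fun x y => ?_, fun x y hxy => ?_,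
      fun x => by simp [siteNorm], fun n x hx => ?_⟩, by simp [h]⟩
    · ext <;> simp; ring
    · rw [adjZ2_iff] at *
      dsimp only
      omega
    · rw [mem_box] at *
      dsimp only
      omega
  · refine ⟨fun x => (x.2, x.1), ⟨fun x => rfl, fun x y => rfl, fun x y hxy => ?_,
      fun x => by simp [siteNorm, add_comm], fun n x hx => ?_⟩, h⟩
    · rw [adjZ2_iff] at *
      dsimp only
      omega
    · rw [mem_box] at *
      dsimp only
      omega
  · refine ⟨fun x => (-x.2, -x.1), ⟨fun x => by simp, fun x y => ?_, fun x y hxy => ?_,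
      fun x => by simp [siteNorm, add_comm], fun n x hx => ?_⟩, by simp [h]⟩
    · ext <;> simp <;> ring
    · rw [adjZ2_iff] at *
      dsimp only
      omega
    · rw [mem_box] at *
      dsimp only
      omega

/-- The enhancement function `φ` seen through the map `T`. -/
def conjEnh (T : Site → Site) (φ : Config → Config) : Config → Config :=
  fun ω => T ⁻¹' φ (T ⁻¹' ω)

namespace IsReflection

variable {T : Site → Site} {r : ℝ} {φ : Config → Config}

theorem preimage_preimage (hT : IsReflection T) (S : Set Site) : T ⁻¹' (T ⁻¹' S) = S := by
  ext z
  simp [hT.invol]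

theorem injective (hT : IsReflection T) : Function.Injective T :=
  Function.Involutive.injective hT.invol

theorem adj_iff (hT : IsReflection T) (x y : Site) : adjZ2 (T x) (T y) ↔ adjZ2 x y :=
  ⟨fun h => by simpa [hT.invol] using hT.adj _ _ h, hT.adj x y⟩

theorem mem_box_iff (hT : IsReflection T) (n : ℤ) (x : Site) :
    T x ∈ PercEnh.box n ↔ x ∈ PercEnh.box n :=
  ⟨fun h => by simpa [hT.invol] using hT.box _ _ h, hT.box n x⟩

theorem mem_siteBall_iff (hT : IsReflection T) (x : Site) : T x ∈ siteBall r ↔ x ∈ siteBall r := by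
  simp [siteBall, hT.norm]

theorem isEnhancement (hT : IsReflection T) (hφ : IsEnhancement r φ) :
    IsEnhancement r (conjEnh T φ) := by
  refine ⟨hφ.1, fun ω z hz => ?_, fun ω ω' h => ?_⟩
  · exact (hT.mem_siteBall_iff z).1 (hφ.2.1 _ hz)
  · refine congrArg (T ⁻¹' ·) (hφ.congr fun z hz => ?_)
    have := Set.ext_iff.1 h (T z)
    simpa [hT.mem_siteBall_iff, hz] using this

theorem monotonic (hmono : Monotonic φ) : Monotonic (conjEnh T φ) :=
  fun _ _ h => preimage_mono (hmono _ _ (preimage_mono h))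

theorem joined (hT : IsReflection T) {S : Set Site} {x y : Site} (h : Joined S x y) :
    Joined (T ⁻¹' S) (T x) (T y) :=
  h.map T hT.adj fun u hu => by simpa [hT.invol] using hu

theorem joined_iff (hT : IsReflection T) {S : Set Site} {x y : Site} :
    Joined (T ⁻¹' S) (T x) (T y) ↔ Joined S x y :=
  ⟨fun h => by simpa [hT.invol, hT.preimage_preimage] using hT.joined h, hT.joined⟩

theorem hasDISRPath (hT : IsReflection T) {S : Set Site} (h : HasDISRPath adjZ2 S) :
    HasDISRPath adjZ2 (T ⁻¹' S) := by
  obtain ⟨γ, h1, h2, h3⟩ := h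
  refine ⟨T ∘ γ, hT.injective.comp h1, fun i => ?_, fun i j => ?_⟩
  · simpa [hT.invol] using h2 i
  · rw [← h3]
    exact hT.adj_iff _ _

theorem essential (hT : IsReflection T) (h : Essential adjZ2 (conjEnh T φ)) :
    Essential adjZ2 φ := by
  obtain ⟨ω, h1, h2⟩ := h
  refine ⟨T ⁻¹' ω, fun h => h1 ?_, ?_⟩
  · simpa [hT.preimage_preimage] using hT.hasDISRPath h
  · simpa [hT.preimage_preimage, conjEnh] using hT.hasDISRPath h2

theorem hasInfiniteCluster (hT : IsReflection T) {S : Set Site}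
    (h : HasInfiniteCluster adjZ2 (T ⁻¹' S)) : HasInfiniteCluster adjZ2 S := by
  by_contra hS
  rw [not_hasInfiniteCluster_iff] at hS
  refine absurd h (not_hasInfiniteCluster_iff.2 fun x => ?_)
  refine ((hS (T x)).preimage hT.injective.injOn).subset fun y hy => ?_
  simpa [hT.preimage_preimage] using hT.joined hy

theorem preimage_enhanced (hT : IsReflection T) (ω : Config) (α : Site → Bool) :
    T ⁻¹' enhanced (conjEnh T φ) ω α ⊆ enhanced φ (T ⁻¹' ω) (α ∘ T) := by
  rintro z (hz | ⟨x, hx, v, hv, hvz⟩)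
  · exact Or.inl hz
  · refine Or.inr ⟨T x, by simpa [hT.invol] using hx, T v, ?_, ?_⟩
    · have : shiftConfig (T x) (T ⁻¹' ω) = T ⁻¹' shiftConfig x ω := by
        ext y
        simp [shiftConfig, hT.map_add, hT.invol]
      rw [this]
      exact hv
    · dsimp only at hvz ⊢
      rw [← hT.map_add, hvz, hT.invol]

end IsReflection

theorem HasInfiniteCluster.mono {S T : Set Site} (hST : S ⊆ T)
    (h : HasInfiniteCluster adjZ2 S) : HasInfiniteCluster adjZ2 T := by
  by_contra hT
  rw [not_hasInfiniteCluster_iff] at hT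
  exact absurd h (not_hasInfiniteCluster_iff.2 fun x => (hT x).subset fun y hy => hy.mono hST)

/-- Some configuration without infinite clusters acquires one when enhanced. -/
def CreatesInfiniteCluster (φ : Config → Config) : Prop :=
  ∃ (ω : Config) (α : Site → Bool),
    ¬ HasInfiniteCluster adjZ2 ω ∧ HasInfiniteCluster adjZ2 (enhanced φ ω α)

theorem IsReflection.createsInfiniteCluster {T : Site → Site} (hT : IsReflection T)
    {φ : Config → Config} (h : CreatesInfiniteCluster (conjEnh T φ)) :
    CreatesInfiniteCluster φ := by
  obtain ⟨ω, α, h1, h2⟩ := h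
  refine ⟨T ⁻¹' ω, α ∘ T, fun h => h1 (hT.hasInfiniteCluster h),
    HasInfiniteCluster.mono (hT.preimage_enhanced ω α) (hT.hasInfiniteCluster ?_)⟩
  rwa [hT.preimage_preimage]

/-! ### Routing the two boundary sites to opposite sides of a larger box -/

/-- A pattern in a box, made of two separated parts, whose only sites on the vertical sides of the
box are two opposite ones, which are in different parts and become joined after the
enhancement at the origin. -/
def HorizontallyPivotal (r : ℝ) (φ : Config → Config) : Prop :=
  ∃ (M c : ℤ) (X Y : Set Site), siteBall r ⊆ box (M - 1) ∧ X ⊆ box M ∧ Y ⊆ box M ∧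
    (-M, c) ∈ X ∧ (M, c) ∈ Y ∧ (∀ z ∈ X, z.1 = -M ∧ z.2 = c ∨ -M < z.1 ∧ z.1 < M) ∧
    (∀ z ∈ Y, z.1 = M ∧ z.2 = c ∨ -M < z.1 ∧ z.1 < M) ∧
    (∀ u ∈ X, ∀ v ∈ Y, u ≠ v ∧ ¬ adjZ2 u v) ∧
    Joined (X ∪ Y ∪ φ (X ∪ Y)) (-M, c) (M, c)

/-- The boundary of the box of radius `n`, without the site `(n, c)` and its two neighbours. -/
def brokenRing (n c : ℤ) : Set Site :=
  {z | z ∈ box n ∧ z ∉ box (n - 1) ∧ ¬ (z.1 = n ∧ c - 1 ≤ z.2 ∧ z.2 ≤ c + 1)}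

theorem joined_brokenRing {S : Set Site} {n c : ℤ} (hS : brokenRing n c ⊆ S) (hc : -n < c)
    (hc' : c < n) {z : Site} (hz : z ∈ brokenRing n c) : Joined S (-n, c) z := by
  obtain ⟨x, y⟩ := z
  have hleft : ∀ t, -n ≤ t → t ≤ n → (-n, t) ∈ S := fun t h1 h2 => hS (by
    simp only [brokenRing, mem_ofPred_eq, mem_box]
    omega)
  have hleft' : ∀ t, -n ≤ t → t ≤ n → Joined S (-n, c) (-n, t) := fun t h1 h2 => by
    rcases le_total c t with h | h
    · exact Joined.vertical h fun s hs hs' => hleft s (by omega) (by omega)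
    · exact (Joined.vertical h fun s hs hs' => hleft s (by omega) (by omega)).symm
  have hhor : ∀ s t, (s = n ∨ s = -n) → -n ≤ t → t ≤ n → (c + 1 < s ∨ s < c - 1 ∨ t < n) →
      Joined S (-n, c) (t, s) := fun s t hs h1 h2 h3 =>
    (hleft' s (by omega) (by omega)).trans (Joined.horizontal h1 fun u hu hu' => hS (by
      simp only [brokenRing, mem_ofPred_eq, mem_box]
      omega))
  simp only [brokenRing, mem_ofPred_eq, mem_box] at hz
  have hcase : x = -n ∨ y = n ∨ y = -n ∨ (x = n ∧ c + 1 < y) ∨ (x = n ∧ y < c - 1) := by omega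
  rcases hcase with rfl | rfl | rfl | ⟨rfl, hy⟩ | ⟨rfl, hy⟩
  · exact hleft' y (by omega) (by omega)
  · exact hhor _ x (by omega) (by omega) (by omega) (by omega)
  · exact hhor _ x (by omega) (by omega) (by omega) (by omega)
  · refine (hhor x x (by omega) (by omega) (by omega) (by omega)).trans
      (Joined.vertical (by omega) fun s hs hs' => hS ?_).symm
    simp only [brokenRing, mem_ofPred_eq, mem_box]
    omega
  · refine (hhor (-x) x (by omega) (by omega) (by omega) (by omega)).trans
      (Joined.vertical (by omega) fun s hs hs' => hS ?_)
    simp only [brokenRing, mem_ofPred_eq, mem_box]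
    omega

theorem horizontallyPivotal_of_right {r : ℝ} {φ : Config → Config} (hφ : IsEnhancement r φ)
    {N : ℤ} {ζ : Set Site} {a b : Site} (hr : siteBall r ⊆ box (N - 1)) (hζ : ζ ⊆ box N)
    (ha : a ∈ ζ) (hb : b ∈ ζ) (ha' : a ∉ box (N - 1))
    (hbd : ∀ z ∈ ζ, z ∉ box (N - 1) → z = a ∨ z = b) (hab : ¬ Joined ζ a b)
    (hab' : Joined (ζ ∪ φ ζ) a b) (hbN : b.1 = N) : HorizontallyPivotal r φ := by
  obtain ⟨p, c⟩ := b
  obtain rfl : p = N := hbN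
  obtain ⟨a₁, a₂⟩ := a
  have hN : 1 ≤ p := by
    have h0 : (0 : Site) ∈ siteBall r := by simpa [siteBall, siteNorm] using hφ.1
    have h1 := hr h0
    simp only [mem_box, Prod.fst_zero, Prod.snd_zero] at h1
    omega
  have hne : ¬ (a₁ = p ∧ c - 1 ≤ a₂ ∧ a₂ ≤ c + 1) := by
    rintro ⟨rfl, h1, h2⟩
    by_cases h : a₂ = c
    · subst h
      exact hab (SimpleGraph.Reachable.refl _)
    · refine hab (Joined.of_adj ?_ ha hb)
      rw [adjZ2_iff]
      dsimp only
      omega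
  have haN := hζ ha
  have hbN := hζ hb
  have hbd' : ∀ z ∈ ζ, z ∈ box (p - 1) ∨ z = (a₁, a₂) ∨ z = (p, c) := fun z hz => by
    by_cases h : z ∈ box (p - 1)
    · exact Or.inl h
    · exact Or.inr (hbd z hz h)
  set C : Set Site := {z | Joined ζ (a₁, a₂) z} with hC
  have hCζ : C ⊆ ζ := fun z hz => Joined.mem hz ha
  set D : Set Site := {z | z ∈ box (p + 1) ∧ z ∉ box p ∧ adjZ2 (a₁, a₂) z} with hD
  set X : Set Site := C ∪ D ∪ brokenRing (p + 2) c ∪ {(-(p + 3), c)} with hX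
  set E : Set Site := {z | z.2 = c ∧ p + 1 ≤ z.1 ∧ z.1 ≤ p + 3} with hE
  set Y : Set Site := (ζ \ C) ∪ E with hY
  have hζXY : ζ ⊆ X ∪ Y := fun z hz => by
    by_cases h : z ∈ C
    · exact Or.inl (Or.inl (Or.inl (Or.inl h)))
    · exact Or.inr (Or.inl ⟨hz, h⟩)
  have hφXY : φ (X ∪ Y) = φ ζ := hφ.congr fun z hz => by
    refine ⟨fun h => ?_, fun h => hζXY h⟩
    have hz := hr hz
    simp only [mem_box] at hz
    rcases h with (((h | h) | h) | h) | (h | h)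
    · exact hCζ h
    · simp only [hD, mem_ofPred_eq, mem_box] at h
      omega
    · simp only [brokenRing, mem_ofPred_eq, mem_box] at h
      omega
    · obtain rfl : z = _ := h
      dsimp only at hz
      omega
    · exact h.1
    · simp only [hE, mem_ofPred_eq] at h
      omega
  simp only [mem_box] at haN hbN ha'
  refine ⟨p + 3, c, X, Y, ?_, ?_, ?_, ?_, ?_, ?_, ?_, ?_, ?_⟩
  · exact hr.trans (box_mono (by omega))
  · rintro z (((h | h) | h) | h)
    · exact box_mono (by omega) (hζ (hCζ h))
    · exact box_mono (by omega) h.1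
    · exact box_mono (by omega) h.1
    · obtain rfl : z = _ := h
      simp only [mem_box]
      omega
  · rintro z (h | h)
    · exact box_mono (by omega) (hζ h.1)
    · simp only [hE, mem_ofPred_eq] at h
      rw [mem_box]
      omega
  · exact Or.inr rfl
  · exact Or.inr ⟨rfl, by dsimp only; omega, le_rfl⟩
  · rintro z (((h | h) | h) | h)
    · have := hζ (hCζ h)
      rw [mem_box] at this
      omega
    · have := h.1
      rw [mem_box] at this
      omega
    · have := h.1
      rw [mem_box] at this
      omega
    · obtain rfl : z = _ := h
      simp
  · rintro z (h | h)
    · have := hζ h.1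
      rw [mem_box] at this
      omega
    · simp only [hE, mem_ofPred_eq] at h
      omega
  · have hnb : ∀ u v, u ∈ C → v ∈ ζ \ C → u ≠ v ∧ ¬ adjZ2 u v := fun u v hu hv =>
      ⟨fun h => hv.2 (h ▸ hu), fun h =>
        hv.2 (SimpleGraph.Reachable.trans hu (Joined.of_adj h (hCζ hu) hv.1))⟩
    have haC : (a₁, a₂) ∈ C := SimpleGraph.Reachable.refl _
    have hCb : ∀ u ∈ C, u ∈ box (p - 1) ∨ u = (a₁, a₂) := fun u hu => by
      rcases hbd' u (hCζ hu) with h | h | h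
      · exact Or.inl h
      · exact Or.inr h
      · exact absurd (h ▸ hu) hab
    have hYb : ∀ v ∈ ζ \ C, v ∈ box (p - 1) ∨ v = (p, c) := fun v hv => by
      rcases hbd' v hv.1 with h | h | h
      · exact Or.inl h
      · exact absurd (h ▸ haC) hv.2
      · exact Or.inr h
    suffices ∀ u v, u ∈ X → v ∈ Y → ¬ (u = v ∨ adjZ2 u v) from
      fun u hu v hv => not_or.1 (this u v hu hv)
    rintro ⟨u₁, u₂⟩ ⟨v₁, v₂⟩ (((hu | hu) | hu) | hu) (hv | hv)
    · exact not_or.2 (hnb _ _ hu hv)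
    · replace hu := hCb _ hu
      simp only [hE, mem_ofPred_eq, mem_box, Prod.mk.injEq, adjZ2_iff] at hu hv ⊢
      omega
    · replace hv := hYb _ hv
      simp only [hD, mem_ofPred_eq, mem_box, Prod.mk.injEq, adjZ2_iff] at hu hv ⊢
      omega
    · simp only [hD, hE, mem_ofPred_eq, mem_box, Prod.mk.injEq, adjZ2_iff] at hu hv ⊢
      omega
    · replace hv := hYb _ hv
      simp only [brokenRing, mem_ofPred_eq, mem_box, Prod.mk.injEq, adjZ2_iff] at hu hv ⊢
      omega
    · simp only [brokenRing, hE, mem_ofPred_eq, mem_box, Prod.mk.injEq, adjZ2_iff] at hu hv ⊢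
      omega
    · replace hv := hYb _ hv
      simp only [mem_singleton_iff, mem_box, Prod.mk.injEq, adjZ2_iff] at hu hv ⊢
      omega
    · simp only [mem_singleton_iff, hE, mem_ofPred_eq, Prod.mk.injEq, adjZ2_iff] at hu hv ⊢
      omega
  · rw [hφXY]
    obtain ⟨d, hd, e, he, hde⟩ : ∃ d ∈ D, ∃ e ∈ brokenRing (p + 2) c, adjZ2 d e := by
      have hcase : a₁ = -p ∨ a₂ = p ∨ a₂ = -p ∨ a₁ = p := by omega
      rcases hcase with h | h | h | h
      · refine ⟨(-p - 1, a₂), ?_, (-p - 2, a₂), ?_, ?_⟩ <;>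
          simp only [hD, brokenRing, mem_ofPred_eq, mem_box, adjZ2_iff, true_and] <;> omega
      · refine ⟨(a₁, p + 1), ?_, (a₁, p + 2), ?_, ?_⟩ <;>
          simp only [hD, brokenRing, mem_ofPred_eq, mem_box, adjZ2_iff, true_and] <;> omega
      · refine ⟨(a₁, -p - 1), ?_, (a₁, -p - 2), ?_, ?_⟩ <;>
          simp only [hD, brokenRing, mem_ofPred_eq, mem_box, adjZ2_iff, true_and] <;> omega
      · refine ⟨(p + 1, a₂), ?_, (p + 2, a₂), ?_, ?_⟩ <;>
          simp only [hD, brokenRing, mem_ofPred_eq, mem_box, adjZ2_iff, true_and] <;> omega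
    have hring : brokenRing (p + 2) c ⊆ X ∪ Y ∪ φ ζ := fun z hz =>
      Or.inl (Or.inl (Or.inl (Or.inr hz)))
    have hDS : D ⊆ X ∪ Y ∪ φ ζ := fun z hz => Or.inl (Or.inl (Or.inl (Or.inl (Or.inr hz))))
    have hES : E ⊆ X ∪ Y ∪ φ ζ := fun z hz => Or.inl (Or.inr (Or.inr hz))
    have hζS : ζ ⊆ X ∪ Y ∪ φ ζ := hζXY.trans subset_union_left
    have hstart : (-(p + 2), c) ∈ brokenRing (p + 2) c := by
      simp only [brokenRing, mem_ofPred_eq, mem_box]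
      omega
    have h1 : Joined (X ∪ Y ∪ φ ζ) (-(p + 3), c) (-(p + 2), c) := by
      refine Joined.of_adj ?_ (Or.inl (Or.inl (Or.inr rfl))) (hring hstart)
      simp only [adjZ2_iff, true_and]
      omega
    have h2 : Joined (X ∪ Y ∪ φ ζ) (-(p + 2), c) e :=
      joined_brokenRing hring (by omega) (by omega) he
    have h3 := Joined.of_adj (adjZ2_symm hde) (hring he) (hDS hd)
    have h4 := Joined.of_adj (adjZ2_symm hd.2.2) (hDS hd) (hζS ha)
    have h5 := hab'.mono (union_subset_union_left (φ ζ) hζXY)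
    have h6 : Joined (X ∪ Y ∪ φ ζ) (p, c) (p + 3, c) := by
      refine Joined.horizontal (by omega) fun t h1 h2 => ?_
      rcases h1.eq_or_lt with rfl | h1
      · exact hζS hb
      · exact hES ⟨rfl, h1, h2⟩
    exact h1.trans (h2.trans (h3.trans (h4.trans (h5.trans h6))))

theorem LocallyPivotal.exists_horizontallyPivotal {r : ℝ} {φ : Config → Config}
    (hφ : IsEnhancement r φ) (h : LocallyPivotal r φ) :
    ∃ T, IsReflection T ∧ HorizontallyPivotal r (conjEnh T φ) := by
  obtain ⟨N, ζ, a, b, hr, hζ, ha, hb, ha', hb', hbd, hab, hab'⟩ := h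
  obtain ⟨T, hT, hTb⟩ := exists_isReflection (hζ hb) hb'
  refine ⟨T, hT, horizontallyPivotal_of_right (ζ := T ⁻¹' ζ) (a := T a) (b := T b)
    (hT.isEnhancement hφ) hr ?_ ?_ ?_ ?_ ?_ ?_ ?_ hTb⟩
  · exact fun z hz => (hT.mem_box_iff _ _).1 (hζ hz)
  · simpa [hT.invol] using ha
  · simpa [hT.invol] using hb
  · rwa [hT.mem_box_iff]
  · intro z hz hz'
    rw [← hT.mem_box_iff] at hz'
    refine (hbd _ hz hz').imp (fun h => ?_) fun h => ?_ <;> rw [← h, hT.invol]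
  · rwa [hT.joined_iff]
  · rw [conjEnh, hT.preimage_preimage, ← preimage_union, hT.joined_iff]
    exact hab'


theorem HorizontallyPivotal.essential {r : ℝ} {φ : Config → Config} (hφ : IsEnhancement r φ)
    (h : HorizontallyPivotal r φ) : Essential adjZ2 φ := by
  obtain ⟨M, c, X, Y, hr, hXM, hYM, hX, hY, hXs, hYs, hXY, hjoin⟩ := h
  have hM : 1 ≤ M := by
    have h0 : (0 : Site) ∈ siteBall r := by simpa [siteBall, siteNorm] using hφ.1
    have h1 := hr h0
    simp only [mem_box, Prod.fst_zero, Prod.snd_zero] at h1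
    omega
  have hc := hXM hX
  simp only [mem_box] at hc
  set A : Set Site := X ∪ {z | z.2 = c ∧ z.1 ≤ -M} with hA
  set B : Set Site := Y ∪ {z | z.2 = c ∧ M ≤ z.1} with hB
  have hAs : ∀ z ∈ A, z.1 < M ∧ -M ≤ z.2 ∧ z.2 ≤ M ∧ (z.1 ≤ -M → z.2 = c) := by
    rintro z (h | h)
    · have h1 := hXs z h
      have h2 := hXM h
      rw [mem_box] at h2
      omega
    · rw [mem_ofPred_eq] at h
      omega
  have hBs : ∀ z ∈ B, -M < z.1 ∧ -M ≤ z.2 ∧ z.2 ≤ M ∧ (M ≤ z.1 → z.2 = c) := by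
    rintro z (h | h)
    · have h1 := hYs z h
      have h2 := hYM h
      rw [mem_box] at h2
      omega
    · rw [mem_ofPred_eq] at h
      omega
  have hAB : ∀ u ∈ A, ∀ v ∈ B, ¬ adjZ2 u v := by
    rintro ⟨u₁, u₂⟩ hu ⟨v₁, v₂⟩ hv huv
    have hu' := hAs _ hu
    have hv' := hBs _ hv
    rw [adjZ2_iff] at huv
    rcases hu with hu | hu <;> rcases hv with hv | hv
    · exact (hXY _ hu _ hv).2 ((adjZ2_iff _ _).2 huv)
    · simp only [mem_ofPred_eq] at hv hu' hv' huv
      obtain ⟨rfl, rfl⟩ : v₁ = M ∧ v₂ = c := by omega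
      exact (hXY _ hu _ hY).2 ((adjZ2_iff _ _).2 huv)
    · simp only [mem_ofPred_eq] at hu hu' hv' huv
      obtain ⟨rfl, rfl⟩ : u₁ = -M ∧ u₂ = c := by omega
      exact (hXY _ hX _ hv).2 ((adjZ2_iff _ _).2 huv)
    · simp only [mem_ofPred_eq] at hu hv huv
      omega
  have hfin : ∀ K : ℤ, (Icc K M ×ˢ Icc (-M) M : Set Site).Finite := fun K =>
    (finite_Icc _ _).prod (finite_Icc _ _)
  have hfin' : ∀ K : ℤ, (Icc (-M) K ×ˢ Icc (-M) M : Set Site).Finite := fun K =>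
    (finite_Icc _ _).prod (finite_Icc _ _)
  have hφω : φ (A ∪ B) = φ (X ∪ Y) := hφ.congr fun z hz => by
    have hz := hr hz
    rw [mem_box] at hz
    simp only [hA, hB, mem_union, mem_ofPred_eq]
    constructor
    · rintro ((h | h) | (h | h))
      · exact Or.inl h
      · omega
      · exact Or.inr h
      · omega
    · exact Or.imp Or.inl Or.inl
  refine ⟨A ∪ B, ?_, ?_⟩
  · rintro ⟨γ, hγ, hγω, hγadj⟩
    have hsucc : ∀ i, adjZ2 (γ i) (γ (i + 1)) := fun i => (hγadj i _).2 (Or.inl rfl)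
    by_cases h0 : γ 0 ∈ A
    · have hall : ∀ i, γ i ∈ A := fun i => by
        induction i using Int.induction_on with
        | zero => exact h0
        | succ i ih => exact (hγω _).resolve_right fun h => hAB _ ih _ h (hsucc _)
        | pred i ih =>
          refine (hγω _).resolve_right fun h => hAB _ ih _ h (adjZ2_symm ?_)
          simpa using hsucc (-(i : ℤ) - 1)
      refine not_injective_of_single_end (S := A) (fun z => z.1) ?_ ?_ (-M) ?_ γ hall hsucc hγ
      · intro u v huv
        rw [adjZ2_iff] at huv
        omega
      · refine fun K => (hfin K).subset fun z hz => ?_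
        have := hAs z hz.1
        exact ⟨⟨hz.2, this.1.le⟩, this.2.1, this.2.2.1⟩
      · intro z hz w hw h1 h2
        have h3 := hAs z hz
        have h4 := hAs w hw
        ext <;> omega
    · have h0 : γ 0 ∈ B := (hγω 0).resolve_left h0
      have hall : ∀ i, γ i ∈ B := fun i => by
        induction i using Int.induction_on with
        | zero => exact h0
        | succ i ih =>
          exact (hγω _).resolve_left fun h => hAB _ h _ ih (adjZ2_symm (hsucc _))
        | pred i ih =>
          refine (hγω _).resolve_left fun h => hAB _ h _ ih ?_
          simpa using hsucc (-(i : ℤ) - 1)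
      refine not_injective_of_single_end (S := B) (fun z => -z.1) ?_ ?_ (-M) ?_ γ hall hsucc hγ
      · intro u v huv
        rw [adjZ2_iff] at huv
        omega
      · refine fun K => (hfin' (-K)).subset fun z hz => ?_
        have := hBs z hz.1
        exact ⟨⟨this.1.le, le_neg_of_le_neg hz.2⟩, this.2.1, this.2.2.1⟩
      · intro z hz w hw h1 h2
        have h3 := hBs z hz
        have h4 := hBs w hw
        ext <;> omega
  · rw [hφω]
    have hS : ∀ z ∈ X ∪ Y ∪ φ (X ∪ Y),
        (z.1 = -M ∧ z.2 = c) ∨ (z.1 = M ∧ z.2 = c) ∨ (-M < z.1 ∧ z.1 < M) := by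
      rintro z ((h | h) | h)
      · exact (hXs z h).imp id Or.inr
      · exact Or.inr (hYs z h)
      · have := hr (hφ.2.1 _ h)
        rw [mem_box] at this
        omega
    refine hasDISRPath_of_rays (S := X ∪ Y ∪ φ (X ∪ Y)) (ρ := fun k => (-M - k, c))
      (σ := fun k => (M + k, c)) ?_ ?_ ?_ ?_ ?_ ?_ ?_ ?_ ?_ ?_
    · exact union_subset_union_left _ (union_subset_union subset_union_left subset_union_left)
    · exact fun k => Or.inl (Or.inl (Or.inr ⟨rfl, by dsimp only; omega⟩))
    · exact fun k => Or.inl (Or.inr (Or.inr ⟨rfl, by dsimp only; omega⟩))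
    · exact Or.inl (Or.inl (by simpa using hX))
    · simpa using hjoin
    · intro i j hij
      simp only [ne_eq, Prod.mk.injEq, adjZ2_iff, and_true, true_and]
      omega
    · intro i j hij
      simp only [ne_eq, Prod.mk.injEq, adjZ2_iff, and_true, true_and]
      omega
    · intro i j hi hj
      simp only [ne_eq, Prod.mk.injEq, adjZ2_iff]
      omega
    · rintro k hk ⟨z₁, z₂⟩ hz
      have := hS _ hz
      simp only [ne_eq, Prod.mk.injEq, adjZ2_iff] at this ⊢
      omega
    · rintro k hk ⟨z₁, z₂⟩ hz
      have := hS _ hz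
      simp only [ne_eq, Prod.mk.injEq, adjZ2_iff] at this ⊢
      omega

theorem HorizontallyPivotal.createsInfiniteCluster {r : ℝ} {φ : Config → Config}
    (hφ : IsEnhancement r φ) (hmono : Monotonic φ) (h : HorizontallyPivotal r φ) :
    CreatesInfiniteCluster φ := by
  obtain ⟨M, c, X, Y, hr, hXM, hYM, hX, hY, hXs, hYs, hXY, hjoin⟩ := h
  have hM : 1 ≤ M := by
    have h0 : (0 : Site) ∈ siteBall r := by simpa [siteBall, siteNorm] using hφ.1
    have h1 := hr h0
    simp only [mem_box, Prod.fst_zero, Prod.snd_zero] at h1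
    omega
  obtain ⟨P, hP⟩ : ∃ P, P = 2 * M + 1 := ⟨_, rfl⟩
  let v : ℤ → Site := fun k => (k * P, 0)
  let ω : Config := {z | ∃ k, z - v k ∈ X ∪ Y}
  have hω : ∀ k, ∀ z ∈ X ∪ Y, z + v k ∈ ω := fun k z hz => ⟨k, by rwa [add_sub_cancel_right]⟩
  refine ⟨ω, fun _ => true, not_hasInfiniteCluster_iff.2 fun x => ?_, ?_⟩
  · let L : ℤ → Set Site := fun k => {z | z - v k ∈ X} ∪ {z | z - v (k - 1) ∈ Y}
    have hLfin : ∀ k, (L k).Finite := fun k =>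
      (((finite_box M).subset hXM).preimage sub_left_injective.injOn).union
        (((finite_box M).subset hYM).preimage sub_left_injective.injOn)
    have hclose : ∀ k j : ℤ, -(2 * P) < k * P - j * P → k * P - j * P < 2 * P →
        j = k - 1 ∨ j = k ∨ j = k + 1 := fun k j h1 h2 => by
      have h3 : -2 < k - j := by nlinarith
      have h4 : k - j < 2 := by nlinarith
      omega
    have hclosed : ∀ k u w, u ∈ L k → u ∈ ω → w ∈ ω → adjZ2 u w → w ∈ L k := by
      rintro k u w (hu | hu) - ⟨j, hw⟩ huw
      · have hu' := hXs _ hu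
        have huw' := (adjZ2_iff _ _).1 huw
        have hw' : -M ≤ (w - v j).1 ∧ (w - v j).1 ≤ M := by
          have := union_subset hXM hYM hw
          rw [mem_box] at this
          omega
        simp only [Prod.fst_sub, Prod.snd_sub, v] at hu' hw'
        rcases hclose k j (by omega) (by omega) with rfl | rfl | rfl
        · rw [sub_one_mul] at hw'
          refine Or.inr (hw.resolve_left fun h => ?_)
          have h' := hXs _ h
          simp only [Prod.fst_sub, Prod.snd_sub, v, sub_one_mul] at h'
          omega
        · exact Or.inl (hw.resolve_right fun h => (hXY _ hu _ h).2 (adjZ2_sub _ huw))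
        · rw [add_one_mul] at hw'
          omega
      · have hu' := hYs _ hu
        have huw' := (adjZ2_iff _ _).1 huw
        have hw' : -M ≤ (w - v j).1 ∧ (w - v j).1 ≤ M := by
          have := union_subset hXM hYM hw
          rw [mem_box] at this
          omega
        simp only [Prod.fst_sub, Prod.snd_sub, v] at hu' hw'
        rcases hclose (k - 1) j (by omega) (by omega) with rfl | rfl | h
        · rw [sub_one_mul (k - 1)] at hw'
          omega
        · exact Or.inr (hw.resolve_left fun h =>
            (hXY _ h _ hu).2 (adjZ2_symm (adjZ2_sub _ huw)))
        · obtain rfl : j = k := by omega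
          rw [sub_one_mul] at hu'
          refine Or.inl (hw.resolve_right fun h => ?_)
          have h' := hYs _ h
          simp only [Prod.fst_sub, Prod.snd_sub, v] at h'
          omega
    by_cases hx : x ∈ ω
    · obtain ⟨k, hk⟩ : ∃ k, x ∈ L k := by
        obtain ⟨k, hk | hk⟩ := hx
        · exact ⟨k, Or.inl hk⟩
        · exact ⟨k + 1, Or.inr (by simpa using hk)⟩
      exact (hLfin k).subset fun y hy => Joined.mem_of_closed hy hk (hclosed k)
    · refine (finite_singleton x).subset fun y hy => Joined.mem_of_closed hy rfl ?_
      rintro u w rfl hu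
      exact absurd hu hx
  · by_contra hfin
    rw [not_hasInfiniteCluster_iff] at hfin
    have hcell : ∀ k, Joined (enhanced φ ω fun _ => true) ((-M, c) + v k) ((M, c) + v k) :=
      fun k => hjoin.map (· + v k) (fun _ _ => adjZ2_add _) (by
        rintro u (hu | hu)
        · exact Or.inl (hω k u hu)
        · exact Or.inr ⟨v k, rfl, u, hmono _ _ (fun z hz => hω k z hz) hu, rfl⟩)
    have hchain : ∀ n : ℕ, Joined (enhanced φ ω fun _ => true) ((-M, c) + v 0) ((-M, c) + v n) := by
      intro n
      induction n with
      | zero => exact SimpleGraph.Reachable.refl _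
      | succ n ih =>
        refine ih.trans ((hcell n).trans (Joined.of_adj ?_ (Or.inl (hω _ _ (Or.inr hY)))
          (Or.inl (hω _ _ (Or.inl hX)))))
        simp only [adjZ2_iff, v, Prod.fst_add, Prod.snd_add, Nat.cast_succ, add_one_mul, true_and]
        omega
    refine infinite_of_injective_forall_mem (f := fun n : ℕ => ((-M, c) + v n : Site)) ?_ hchain
      (hfin _)
    intro m n hmn
    have : (m : ℤ) * P = n * P := by simpa [v] using hmn
    exact_mod_cast mul_right_cancel₀ (by omega : P ≠ 0) this

/-- a monotonic enhancement of site percolation on `ℤ²` is essential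
iff there exist a configuration `ω` with no infinite open cluster and activation
variables `α` such that the enhanced configuration `ω̂(ω,α)` contains an infinite
open cluster. -/
theorem monotonic_essential_iff_creates_infinite_cluster
    (R₀ : ℝ) (φ : Config → Config) (hφ : IsEnhancement R₀ φ) (hmono : Monotonic φ) :
    Essential adjZ2 φ ↔
      ∃ (ω : Config) (α : Site → Bool),
        ¬ HasInfiniteCluster adjZ2 ω ∧ HasInfiniteCluster adjZ2 (enhanced φ ω α) := by
  constructor
  · intro h
    obtain ⟨T, hT, hp⟩ := (LocallyPivotal.of_essential hφ h).exists_horizontallyPivotal hφ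
    exact hT.createsInfiniteCluster
      (hp.createsInfiniteCluster (hT.isEnhancement hφ) (IsReflection.monotonic hmono))
  · rintro ⟨ω, α, hω, hinf⟩
    obtain ⟨T, hT, hp⟩ :=
      (LocallyPivotal.of_hasInfiniteCluster hφ hmono hω hinf).exists_horizontallyPivotal hφ
    exact hT.essential (hp.essential (hT.isEnhancement hφ))

end PercEnh
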